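/- Optimality of the multilevel sample allocation: Let L ≥ 0 be an integer, δ > 0, and for each 0 ≤ ℓ ≤ L let δ_ℓ > 0 and h_ℓ > 0. Then for all positive reals n₀, …, n_L satisfying the constraint ∑_{ℓ=0}^{L} δ_ℓ/n_ℓ = δ², one has ∑_{ℓ=0}^{L} n_ℓ/h_ℓ ≥ δ^{−2}·( ∑_{ℓ=0}^{L} √(δ_ℓ/h_ℓ) )². Moreover, equality holds for the choice n_ℓ = δ^{−2}·√(δ_ℓ·h_ℓ)·∑_{j=0}^{L} √(δ_j/h_j), which satisfies the constraint. -/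

import Mathlib

open Finset

lemma Real.sqrt_mul_div_right {a b : ℝ} (ha : 0 < a) :
    √(a * b) / b = √(a / b) := by
  rw [Real.sqrt_mul ha.le, Real.sqrt_div ha.le, mul_div_assoc, Real.sqrt_div_self',
    mul_one_div]

lemma Real.div_sqrt_mul {a b : ℝ} (ha : 0 < a) : a / √(a * b) = √(a / b) := by
  rw [Real.sqrt_mul ha.le, Real.sqrt_div ha.le, ← div_div, Real.div_sqrt]

/-- Optimality of the multilevel sample allocation: subject to the variance
constraint `∑ δℓ/nℓ = δ²`, the cost `∑ nℓ/hℓ` is at least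
`δ⁻²(∑ √(δℓ/hℓ))²`, and the stated choice of `nℓ` satisfies the constraint and
attains equality. -/
theorem multilevel_sample_allocation_optimality
    (L : ℕ) (δ : ℝ) (hδ : 0 < δ)
    (δℓ hℓ : Fin (L + 1) → ℝ)
    (hδℓ : ∀ ℓ, 0 < δℓ ℓ) (hhℓ : ∀ ℓ, 0 < hℓ ℓ) :
    (∀ n : Fin (L + 1) → ℝ, (∀ ℓ, 0 < n ℓ) →
      (∑ ℓ, δℓ ℓ / n ℓ) = δ ^ 2 →
      (∑ ℓ, n ℓ / hℓ ℓ) ≥ δ ^ (-2 : ℤ) * (∑ ℓ, Real.sqrt (δℓ ℓ / hℓ ℓ)) ^ 2) ∧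
    ((∑ ℓ, δℓ ℓ /
        (δ ^ (-2 : ℤ) * Real.sqrt (δℓ ℓ * hℓ ℓ) * ∑ j, Real.sqrt (δℓ j / hℓ j)))
      = δ ^ 2) ∧
    ((∑ ℓ, (δ ^ (-2 : ℤ) * Real.sqrt (δℓ ℓ * hℓ ℓ) * ∑ j, Real.sqrt (δℓ j / hℓ j)) / hℓ ℓ)
      = δ ^ (-2 : ℤ) * (∑ ℓ, Real.sqrt (δℓ ℓ / hℓ ℓ)) ^ 2) := by
  have hS : 0 < ∑ j, √(δℓ j / hℓ j) :=
    sum_pos (fun j _ => Real.sqrt_pos.2 (div_pos (hδℓ j) (hhℓ j))) univ_nonempty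
  rw [zpow_neg, zpow_ofNat]
  refine ⟨fun n hn hc => ?_, ?_, ?_⟩
  · rw [ge_iff_le, inv_mul_le_iff₀ (by positivity), ← hc]
    refine sum_sq_le_sum_mul_sum_of_sq_le_mul _ (fun i _ => (div_pos (hδℓ i) (hn i)).le)
      (fun i _ => (div_pos (hn i) (hhℓ i)).le) (fun i _ => ?_)
    rw [Real.sq_sqrt (div_pos (hδℓ i) (hhℓ i)).le, div_mul_div_cancel₀ (hn i).ne']
  · calc
      _ = ∑ ℓ, √(δℓ ℓ / hℓ ℓ) * (δ ^ 2 / ∑ j, √(δℓ j / hℓ j)) := by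
        refine sum_congr rfl fun ℓ _ => ?_
        rw [← Real.div_sqrt_mul (hδℓ ℓ)]
        have := Real.sqrt_pos.2 (mul_pos (hδℓ ℓ) (hhℓ ℓ))
        field_simp
      _ = δ ^ 2 := by rw [← sum_mul, mul_div_cancel₀ _ hS.ne']
  · calc
      _ = ∑ ℓ, √(δℓ ℓ / hℓ ℓ) * ((δ ^ 2)⁻¹ * ∑ j, √(δℓ j / hℓ j)) := by
        refine sum_congr rfl fun ℓ _ => ?_
        rw [← Real.sqrt_mul_div_right (hδℓ ℓ)]
        ring
      _ = _ := by rw [← sum_mul]; ring
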